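/- Let (Ω, 𝓔, μ) be a complete σ-finite measure space, H a separable complex Hilbert space, and T : Ω → (H →ₗ.[ℂ] H) a random closed operator, i.e. each T ω is a partially defined linear operator whose graph is a closed subspace of H × H, and ω ↦ (graph of T ω, as a subset of H × H) is a random set. Then for every open set U ⊆ ℂ the set {ω ∈ Ω | ∃ z ∈ U, ∃ f ∈ dom(T ω), f ≠ 0 ∧ T ω f = z • f} belongs to 𝓔. In other words, the eigenvalue spectrum of a random closed operator is a random set. -/

import Mathlib

open MeasureTheory

open Filter Topology in
/-- A closed convex set contains the weak limits of its points. -/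
theorem Convex.mem_of_weak_tendsto {ι E : Type*} [NormedAddCommGroup E] [NormedSpace ℂ E]
    {s : Set E} (hs : Convex ℝ s) (hc : IsClosed s) {l : Filter ι} [l.NeBot] {x : ι → E} {a : E}
    (hx : ∀ i, x i ∈ s)
    (hlim : ∀ g : StrongDual ℂ E, Tendsto (fun i => g (x i)) l (𝓝 (g a))) : a ∈ s := by
  by_contra ha
  obtain ⟨g, u, hgs, hga⟩ := RCLike.geometric_hahn_banach_closed_point (𝕜 := ℂ) hs hc ha
  have hre : Tendsto (fun i => RCLike.re (g (x i))) l (𝓝 (RCLike.re (g a))) :=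
    (RCLike.continuous_re.tendsto _).comp (hlim g)
  exact hga.not_ge (le_of_tendsto hre (Eventually.of_forall fun i => (hgs _ (hx i)).le))

open Filter Topology in
/-- A bounded family in a Hilbert space converges weakly along any ultrafilter. -/
theorem exists_weak_tendsto_of_norm_le {ι H : Type*} [NormedAddCommGroup H]
    [InnerProductSpace ℂ H] [CompleteSpace H] (l : Ultrafilter ι) {x : ι → H} {R : ℝ}
    (hx : ∀ i, ‖x i‖ ≤ R) :
    ∃ a : H, ∀ g : StrongDual ℂ H, Tendsto (fun i => g (x i)) l (𝓝 (g a)) := by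
  let φ : ι → WeakDual ℂ H :=
    fun i => StrongDual.toWeakDual (InnerProductSpace.toDual ℂ H (x i))
  obtain ⟨ψ, -, hψ⟩ := (WeakDual.isCompact_closedBall (𝕜 := ℂ) (E := H) 0 R).ultrafilter_le_nhds
    (l.map φ) (by
      rw [le_principal_iff]
      refine Filter.mem_map.2 (Eventually.of_forall fun i => ?_)
      simpa [φ] using hx i)
  refine ⟨(InnerProductSpace.toDual ℂ H).symm (WeakDual.toStrongDual ψ), fun g => ?_⟩
  obtain ⟨y, rfl⟩ := (InnerProductSpace.toDual ℂ H).surjective g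
  have hy : Tendsto (fun i => inner ℂ (x i) y) l (𝓝 (ψ y)) :=
    ((WeakDual.eval_continuous y).tendsto ψ).comp hψ
  have hstar := (Complex.continuous_conj.tendsto _).comp hy
  have hψy : inner ℂ ((InnerProductSpace.toDual ℂ H).symm (WeakDual.toStrongDual ψ)) y = ψ y := by
    simp
  rw [← hψy] at hstar
  simpa only [Function.comp_def, inner_conj_symm, InnerProductSpace.toDual_apply_apply] using hstar

/-- The vector pairs `(x, y)` such that `y` is within `ε` of `z • x` for some `z ∈ K`, where `x`
is constrained to have norm less than `R` and to satisfy `1 < re ⟪e, x⟫`. -/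
def approxEigenpairs {H : Type*} [NormedAddCommGroup H] [InnerProductSpace ℂ H]
    (K : Set ℂ) (e : H) (R ε : ℝ) : Set (H × H) :=
  {p | ‖p.1‖ < R ∧ 1 < (inner ℂ e p.1).re ∧ ∃ z ∈ K, ‖p.2 - z • p.1‖ < ε}

theorem isOpen_approxEigenpairs {H : Type*} [NormedAddCommGroup H] [InnerProductSpace ℂ H]
    (K : Set ℂ) (e : H) (R ε : ℝ) : IsOpen (approxEigenpairs K e R ε) := by
  have hnorm : IsOpen {p : H × H | ‖p.1‖ < R} := isOpen_lt (by fun_prop) (by fun_prop)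
  have hinner : IsOpen {p : H × H | 1 < (inner ℂ e p.1).re} :=
    isOpen_lt (by fun_prop) (Complex.continuous_re.comp (continuous_const.inner continuous_fst))
  have heig : IsOpen {p : H × H | ∃ z ∈ K, ‖p.2 - z • p.1‖ < ε} := by
    have : IsOpen (⋃ z ∈ K, {p : H × H | ‖p.2 - z • p.1‖ < ε}) :=
      isOpen_biUnion fun z _ => isOpen_lt (by fun_prop) (by fun_prop)
    convert this using 1
    ext p
    simp
  exact hnorm.inter (hinner.inter heig)

open Filter Topology in
/-- A closed subspace that contains approximate eigenpairs of every precision, with approximate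
eigenvalues in a fixed compact set, contains an exact eigenpair. -/
theorem exists_smul_mem_of_forall_approxEigenpairs {H : Type*} [NormedAddCommGroup H]
    [InnerProductSpace ℂ H] [CompleteSpace H] {G : Submodule ℂ (H × H)}
    (hG : IsClosed (G : Set (H × H))) {K : Set ℂ} (hK : IsCompact K) {e : H} {R : ℝ}
    (h : ∀ n : ℕ, ((G : Set (H × H)) ∩ approxEigenpairs K e R (1 / ((n : ℝ) + 1))).Nonempty) :
    ∃ z ∈ K, ∃ f : H, f ≠ 0 ∧ (f, z • f) ∈ G := by
  choose p hpG hpR hpe z hzK hz using h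
  obtain ⟨f, hf⟩ := exists_weak_tendsto_of_norm_le (hyperfilter ℕ) fun n => (hpR n).le
  obtain ⟨w, hwK, hw⟩ := hK.ultrafilter_le_nhds ((hyperfilter ℕ).map z) (by
    rw [le_principal_iff]
    exact Filter.mem_map.2 (Eventually.of_forall hzK))
  have hw : Tendsto z (hyperfilter ℕ) (𝓝 w) := hw
  have herr : Tendsto (fun n => (p n).2 - z n • (p n).1) (hyperfilter ℕ) (𝓝 0) :=
    (squeeze_zero_norm (fun n => (hz n).le) tendsto_one_div_add_atTop_nhds_zero_nat).mono_left
      Nat.hyperfilter_le_atTop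
  refine ⟨w, hwK, f, ?_, ?_⟩
  · rintro rfl
    have hlim : Tendsto (fun n => (inner ℂ e (p n).1).re) (hyperfilter ℕ) (𝓝 0) := by
      simpa [Function.comp_def] using (Complex.continuous_re.tendsto _).comp (hf (innerSL ℂ e))
    exact absurd (ge_of_tendsto hlim (Eventually.of_forall fun n => (hpe n).le)) (by norm_num)
  · refine (G.restrictScalars ℝ).convex.mem_of_weak_tendsto hG (l := hyperfilter ℕ) hpG
      fun g => ?_
    have h₁ := hf (g.comp (ContinuousLinearMap.inl ℂ H H))
    have h₂ := hw.mul (hf (g.comp (ContinuousLinearMap.inr ℂ H H)))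
    have h₃ := ((g.comp (ContinuousLinearMap.inr ℂ H H)).continuous.tendsto 0).comp herr
    have hsplit : ∀ x y : H, g (x, y) = g.comp (ContinuousLinearMap.inl ℂ H H) x +
        g.comp (ContinuousLinearMap.inr ℂ H H) y := fun x y => by
      simp [← map_add]
    have hlim := (h₁.add h₂).add h₃
    rw [map_zero, add_zero] at hlim
    rw [hsplit, map_smul, smul_eq_mul]
    refine hlim.congr fun n => ?_
    change _ = g ((p n).1, (p n).2)
    rw [hsplit, Function.comp_apply, map_sub, map_smul, smul_eq_mul]
    ring

/-- Every nonzero vector has inner product of real part larger than `1` with some member of a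
given dense sequence. -/
theorem DenseRange.exists_one_lt_re_inner {ι H : Type*} [NormedAddCommGroup H]
    [InnerProductSpace ℂ H] {e : ι → H} (he : DenseRange e) {f : H} (hf : f ≠ 0) :
    ∃ i, 1 < (inner ℂ (e i) f).re := by
  have hopen : IsOpen {v : H | 1 < (inner ℂ v f).re} :=
    isOpen_lt (by fun_prop) (Complex.continuous_re.comp (continuous_id.inner continuous_const))
  refine he.exists_mem_open hopen ⟨((2 / ‖f‖ ^ 2 : ℝ) : ℂ) • f, ?_⟩
  have hn : ‖f‖ ≠ 0 := norm_ne_zero_iff.2 hf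
  have hself : (inner ℂ f f).re = ‖f‖ ^ 2 := inner_self_eq_norm_sq (𝕜 := ℂ) f
  rw [Set.mem_ofPred_eq, inner_smul_left, Complex.conj_ofReal, Complex.re_ofReal_mul, hself,
    div_mul_cancel₀ _ (pow_ne_zero 2 hn)]
  norm_num

/-- An open subset of the plane is a countable union of compact sets. -/
theorem IsOpen.exists_iUnion_isCompact {U : Set ℂ} (hU : IsOpen U) :
    ∃ K : ℕ → Set ℂ, (∀ k, IsCompact (K k)) ∧ ⋃ k, K k = U := by
  obtain ⟨F, hF, -, hFU, hmono⟩ := hU.exists_iUnion_isClosed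
  refine ⟨fun k => F k ∩ Metric.closedBall 0 k,
    fun k => (isCompact_closedBall 0 _).inter_left (hF k), ?_⟩
  rw [Set.iUnion_inter_of_monotone hmono
    fun i j hij => Metric.closedBall_subset_closedBall (by exact_mod_cast hij),
    hFU, Metric.iUnion_closedBall_nat, Set.inter_univ]

/-- The eigenvalue spectrum of a random closed operator is a random set:
for a complete σ-finite measure space `(Ω, 𝓔, μ)`, a separable complex Hilbert
space `H`, and a random closed operator `T` (each `T ω` is a partially defined
linear operator with closed graph, and the graph map is a random set), the
event that the eigenvalue spectrum of `T ω` meets a given open `U ⊆ ℂ` is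
measurable. -/
theorem eigenvalue_spectrum_of_random_closed_operator_is_random_set
    {Ω : Type*} [MeasurableSpace Ω] (μ : Measure Ω) [SigmaFinite μ]
    (hμ : μ.IsComplete)
    {H : Type*} [NormedAddCommGroup H] [InnerProductSpace ℂ H] [CompleteSpace H]
    [SecondCountableTopology H]
    (T : Ω → (H →ₗ.[ℂ] H))
    (hclosed : ∀ ω, IsClosed ((T ω).graph : Set (H × H)))
    (hrandom : ∀ V : Set (H × H), IsOpen V →
      MeasurableSet {ω : Ω | (((T ω).graph : Set (H × H)) ∩ V).Nonempty})
    (U : Set ℂ) (hU : IsOpen U) :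
    MeasurableSet {ω : Ω | ∃ z ∈ U, ∃ f : (T ω).domain,
      (f : H) ≠ 0 ∧ T ω f = z • (f : H)} := by
  obtain ⟨K, hK, rfl⟩ := hU.exists_iUnion_isCompact
  let e : ℕ → H := TopologicalSpace.denseSeq H
  have hset : {ω : Ω | ∃ z ∈ ⋃ k, K k, ∃ f : (T ω).domain, (f : H) ≠ 0 ∧ T ω f = z • (f : H)} =
      ⋃ k : ℕ, ⋃ i : ℕ, ⋃ R : ℕ, ⋂ n : ℕ, {ω : Ω | (((T ω).graph : Set (H × H)) ∩
        approxEigenpairs (K k) (e i) R (1 / ((n : ℝ) + 1))).Nonempty} := by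
    ext ω
    simp only [Set.mem_iUnion, Set.mem_iInter, Set.mem_ofPred_eq]
    constructor
    · rintro ⟨z, ⟨k, hz⟩, f, hf, hfz⟩
      obtain ⟨i, hi⟩ := (TopologicalSpace.denseRange_denseSeq H).exists_one_lt_re_inner hf
      obtain ⟨R, hR⟩ := exists_nat_gt ‖(f : H)‖
      refine ⟨k, i, R, fun n => ⟨(f, T ω f), (T ω).mem_graph f, hR, hi, z, hz, ?_⟩⟩
      rw [hfz, sub_self, norm_zero]
      positivity
    · rintro ⟨k, i, R, h⟩
      obtain ⟨z, hz, f, hf, hfG⟩ :=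
        exists_smul_mem_of_forall_approxEigenpairs (hclosed ω) (hK k) h
      obtain ⟨f', rfl, hf'⟩ := (LinearPMap.mem_graph_iff _).1 hfG
      exact ⟨z, ⟨k, hz⟩, f', hf, hf'⟩
  rw [hset]
  exact .iUnion fun k => .iUnion fun i => .iUnion fun R => .iInter fun n =>
    hrandom _ (isOpen_approxEigenpairs _ _ _ _)
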